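/- Let G be a weighted graph and let d be a divisor on G. Suppose there exists a vertex u with d_rk(u) = ℓ_G(d) such that d is u-reduced (as a divisor on the underlying loopless multigraph (V, m)). Then r_G(d) = ℓ_G(d). -/

import Mathlib

open Finset

variable {V : Type*} [Fintype V] [DecidableEq V]

/-- Intersection number `v · A`. -/
def dot (m : V → V → ℕ) (v : V) (A : Finset V) : ℤ := ∑ w ∈ A, (m v w : ℤ)

/-- The principal divisor `t_Z` associated to a set of vertices `Z`. -/
def tdiv (m : V → V → ℕ) (Z : Finset V) : V → ℤ :=
  fun v => if v ∈ Z then -(dot m v Zᶜ) else dot m v Z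

/-- The subgroup of principal divisors of the multigraph `(V, m)`. -/
def Prin (m : V → V → ℕ) : AddSubgroup (V → ℤ) :=
  AddSubgroup.closure (Set.range (tdiv m))

/-- A divisor is effective if all its values are nonnegative. -/
def Effective (d : V → ℤ) : Prop := ∀ v, 0 ≤ d v

/-- The degree of a divisor. -/
def deg (d : V → ℤ) : ℤ := ∑ v, d v

/-- `d` is linearly equivalent to an effective divisor. -/
def EquivEff (m : V → V → ℕ) (d : V → ℤ) : Prop :=
  ∃ e : V → ℤ, Effective e ∧ d - e ∈ Prin m

/-- The Baker–Norine combinatorial rank of a divisor on a weightless loopless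
multigraph: `-1` if `d` is not equivalent to an effective divisor, and otherwise
the largest `k ≥ 0` such that for every effective divisor `e` of degree `k`,
`d - e` is equivalent to an effective divisor. -/
noncomputable def bnrank (m : V → V → ℕ) (d : V → ℤ) : ℤ :=
  sSup ({-1} ∪ {k : ℤ | 0 ≤ k ∧
    ∀ e : V → ℤ, Effective e → deg e = k → EquivEff m (d - e)})

/-- Connectedness: any two vertices are joined by a path of edges of
positive multiplicity. -/
def Conn (m : V → V → ℕ) : Prop :=
  ∀ v w : V, Relation.ReflTransGen (fun a b => 0 < m a b) v w

/-- `d` is `u`-reduced. -/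
def Reduced (m : V → V → ℕ) (u : V) (d : V → ℤ) : Prop :=
  (∀ v, v ≠ u → 0 ≤ d v) ∧
  ∀ A : Finset V, A.Nonempty → u ∉ A → ∃ v ∈ A, d v < dot m v Aᶜ

open Classical in
/-- `ℓ_G(d)` for a weightless graph: the minimum value of `d` if `d` is
effective, and `-1` otherwise. -/
noncomputable def ell [Nonempty V] (d : V → ℤ) : ℤ :=
  if Effective d then Finset.univ.inf' Finset.univ_nonempty d else -1

/-- Edge multiplicities of the weightless loopless graph `Ĝ` associated to the
weighted graph `(V, m, g)`: for each `v` we add `g v` new vertices, each joined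
to `v` by two edges. -/
def hatm (m : V → V → ℕ) (g : V → ℕ) :
    (V ⊕ Σ v : V, Fin (g v)) → (V ⊕ Σ v : V, Fin (g v)) → ℕ
  | Sum.inl v, Sum.inl w => m v w
  | Sum.inl v, Sum.inr z => if z.1 = v then 2 else 0
  | Sum.inr z, Sum.inl w => if z.1 = w then 2 else 0
  | Sum.inr _, Sum.inr _ => 0

/-- Extension of a divisor on `G` to `Ĝ` by zero on the new vertices. -/
def hatd (g : V → ℕ) (d : V → ℤ) : (V ⊕ Σ v : V, Fin (g v)) → ℤ :=
  Sum.elim d fun _ => 0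

/-- The combinatorial rank of a divisor on the weighted graph `(V, m, g)`,
defined as the Baker–Norine rank of its extension to `Ĝ`. -/
noncomputable def wrank (m : V → V → ℕ) (g : V → ℕ) (d : V → ℤ) : ℤ :=
  bnrank (hatm m g) (hatd g d)

/-- `e^deg`, for an effective divisor `e` on a weighted graph. -/
def edeg (g : V → ℕ) (e : V → ℤ) : V → ℤ :=
  fun v => e v + min (e v) (g v : ℤ)

/-- `d_rk(v) = max (d v - g v) ⌊d v / 2⌋` (note `/` is floor division since
the divisor `2` is positive). -/
def drk (g : V → ℕ) (d : V → ℤ) : V → ℤ :=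
  fun v => max (d v - (g v : ℤ)) (d v / 2)

open Classical in
/-- `ℓ_G(d)` for a weighted graph. -/
noncomputable def ellw [Nonempty V] (g : V → ℕ) (d : V → ℤ) : ℤ :=
  if Effective d then Finset.univ.inf' Finset.univ_nonempty (drk g d) else -1

/-- Every principal divisor is the Laplacian of an integer-valued function. -/
theorem exists_laplacian_of_mem_Prin {V : Type*} [Fintype V] [DecidableEq V]
    {m : V → V → ℕ} {h : V → ℤ} (hh : h ∈ Prin m) :
    ∃ x : V → ℤ, ∀ v, h v = ∑ w, (m v w : ℤ) * (x w - x v) := by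
  unfold Prin at hh
  induction hh using AddSubgroup.closure_induction with
  | mem y hy =>
    obtain ⟨Z, rfl⟩ := hy
    refine ⟨fun v => if v ∈ Z then 1 else 0, fun v => ?_⟩
    by_cases hv : v ∈ Z
    · simp only [tdiv, dot, hv, if_true]
      rw [← Finset.sum_neg_distrib, ← Finset.sum_subset (Finset.subset_univ Zᶜ)]
      · refine Finset.sum_congr rfl fun w hw => ?_
        simp [Finset.mem_compl.mp hw]
      · intro w _ hw
        simp [not_not.mp (mt Finset.mem_compl.mpr hw)]
    · simp [tdiv, dot, hv]
  | zero => exact ⟨0, by simp⟩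
  | add a b _ _ ha hb =>
    obtain ⟨x, hx⟩ := ha
    obtain ⟨y, hy⟩ := hb
    refine ⟨x + y, fun v => ?_⟩
    rw [Pi.add_apply, hx, hy, ← Finset.sum_add_distrib]
    exact Finset.sum_congr rfl fun w _ => by simp only [Pi.add_apply]; ring
  | neg a _ ha =>
    obtain ⟨x, hx⟩ := ha
    refine ⟨-x, fun v => ?_⟩
    rw [Pi.neg_apply, hx, ← Finset.sum_neg_distrib]
    exact Finset.sum_congr rfl fun w _ => by simp only [Pi.neg_apply]; ring

/-- A `u`-reduced divisor which is equivalent to an effective one is nonnegative at `u`. -/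
theorem Reduced.nonneg_of_equivEff {V : Type*} [Fintype V] [DecidableEq V]
    {m : V → V → ℕ} {u : V} {f : V → ℤ} (hf : Reduced m u f) (he : EquivEff m f) :
    0 ≤ f u := by
  obtain ⟨e, he, hp⟩ := he
  obtain ⟨x, hx⟩ := exists_laplacian_of_mem_Prin hp
  obtain ⟨a, -, ha⟩ := Finset.exists_min_image Finset.univ x ⟨u, Finset.mem_univ u⟩
  replace ha : ∀ w, x a ≤ x w := fun w => ha w (Finset.mem_univ w)
  by_cases hu : x u = x a
  · have h0 : 0 ≤ ∑ w, (m u w : ℤ) * (x w - x u) :=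
      Finset.sum_nonneg fun w _ =>
        mul_nonneg (Int.natCast_nonneg _) (by linarith [ha w])
    have h1 := hx u
    rw [Pi.sub_apply] at h1
    linarith [he u]
  · obtain ⟨v, hv, hlt⟩ := hf.2 {w | x w = x a} ⟨a, by simp⟩ (by simpa using hu)
    have hva : x v = x a := by simpa using hv
    have h0 : dot m v ({w | x w = x a} : Finset V)ᶜ ≤ ∑ w, (m v w : ℤ) * (x w - x v) := by
      refine le_trans (Finset.sum_le_sum fun w hw => ?_)
        (Finset.sum_le_sum_of_subset_of_nonneg (Finset.subset_univ _) fun w _ _ =>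
          mul_nonneg (Int.natCast_nonneg _) (by linarith [ha w]))
      have hw' : x w ≠ x a := by simpa using hw
      have h2 : x v + 1 ≤ x w := by
        have := lt_of_le_of_ne (ha w) (Ne.symm hw')
        omega
      exact le_mul_of_one_le_right (Int.natCast_nonneg _) (by linarith)
    have h1 := hx v
    rw [Pi.sub_apply] at h1
    linarith [he v]

/-- Moving `2 * c z` chips from each new vertex `z` of `Ĝ` to its neighbour is a
principal divisor. -/
theorem elim_mem_Prin_hatm {V : Type*} [Fintype V] [DecidableEq V]
    (m : V → V → ℕ) (g : V → ℕ) (c : (Σ v : V, Fin (g v)) → ℤ) :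
    (Sum.elim (fun v => 2 * ∑ i, c ⟨v, i⟩) (fun z => -(2 * c z)) :
      (V ⊕ Σ v : V, Fin (g v)) → ℤ) ∈ Prin (hatm m g) := by
  have key : (Sum.elim (fun v => 2 * ∑ i, c ⟨v, i⟩) (fun z => -(2 * c z)) :
      (V ⊕ Σ v : V, Fin (g v)) → ℤ) = ∑ z, c z • tdiv (hatm m g) {Sum.inr z} := by
    funext y
    rw [Finset.sum_apply]
    rcases y with v | z
    · simp only [Sum.elim_inl, Pi.smul_apply, tdiv, dot, Finset.mem_singleton, reduceCtorEq,
        if_false, Finset.sum_singleton, hatm, smul_eq_mul]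
      rw [Fintype.sum_sigma, Finset.sum_eq_single v]
      · simp [Finset.mul_sum, mul_comm]
      · intro w _ hw
        simp [hw]
      · simp
    · rw [Finset.sum_eq_single z]
      · have : dot (hatm m g) (Sum.inr z) {Sum.inr z}ᶜ = 2 := by
          unfold dot
          rw [Finset.sum_eq_single (Sum.inl z.1)]
          · simp [hatm]
          · rintro (w | w) _ hw
            · have : z.1 ≠ w := fun h => hw (by rw [h])
              simp [hatm, this]
            · simp [hatm]
          · simp
        simp [tdiv, this, mul_comm]
      · intro w _ hw
        simp [tdiv, dot, hatm, Ne.symm hw]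
      · simp
  rw [key]
  exact AddSubgroup.sum_mem _ fun z _ =>
    AddSubgroup.zsmul_mem _ (AddSubgroup.subset_closure (Set.mem_range_self _)) _

/-- A `u`-reduced divisor on `G`, extended to `Ĝ` by `0` or `1` on each new vertex, is
`u`-reduced on `Ĝ`. -/
theorem Reduced.reduced_hatm {V : Type*} [Fintype V] [DecidableEq V]
    {m : V → V → ℕ} {g : V → ℕ} {u : V} {d : V → ℤ} (hd : Reduced m u d)
    {f : (V ⊕ Σ v : V, Fin (g v)) → ℤ} (hfd : ∀ v, v ≠ u → f (Sum.inl v) = d v)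
    (hf0 : ∀ z, 0 ≤ f (Sum.inr z)) (hf2 : ∀ z, f (Sum.inr z) < 2) :
    Reduced (hatm m g) (Sum.inl u) f := by
  refine ⟨?_, fun A hA hu => ?_⟩
  · rintro (v | z) hv
    · have hv' : v ≠ u := fun h => hv (by rw [h])
      rw [hfd v hv']
      exact hd.1 v hv'
    · exact hf0 z
  · by_cases hB : ∃ v, Sum.inl v ∈ A
    · obtain ⟨a, ha⟩ := hB
      obtain ⟨v, hv, hlt⟩ := hd.2 {w | Sum.inl w ∈ A} ⟨a, by simpa using ha⟩ (by simpa using hu)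
      have hv' : Sum.inl v ∈ A := by simpa using hv
      refine ⟨Sum.inl v, hv', ?_⟩
      rw [hfd v fun h => hu (h ▸ hv')]
      refine hlt.trans_le ?_
      have hsub : ({w | Sum.inl w ∈ A} : Finset V)ᶜ.map Function.Embedding.inl ⊆ Aᶜ := by
        intro y hy
        obtain ⟨w, hw, rfl⟩ := Finset.mem_map.mp hy
        simpa using hw
      refine le_trans (le_of_eq ?_) (Finset.sum_le_sum_of_subset_of_nonneg hsub
        fun _ _ _ => Int.natCast_nonneg _)
      rw [Finset.sum_map]
      rfl
    · push Not at hB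
      obtain ⟨y, hy⟩ := hA
      rcases y with v | z
      · exact absurd hy (hB v)
      · refine ⟨Sum.inr z, hy, (hf2 z).trans_le ?_⟩
        have h := Finset.single_le_sum
          (f := fun w => (hatm m g (Sum.inr z) w : ℤ))
          (fun _ _ => Int.natCast_nonneg _) (Finset.mem_compl.mpr (hB z.1))
        refine le_trans ?_ h
        simp [hatm]

/-- Subtracting an effective divisor of degree at most `d_rk v` for all `v` leaves the
divisor `d` equivalent to an effective one on `Ĝ`. -/
theorem equivEff_hatd_sub {V : Type*} [Fintype V] [DecidableEq V]
    (m : V → V → ℕ) (g : V → ℕ) (d : V → ℤ) {e : (V ⊕ Σ v : V, Fin (g v)) → ℤ}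
    (he : Effective e) (hdeg : ∀ v, deg e ≤ drk g d v) :
    EquivEff (hatm m g) (hatd g d - e) := by
  have hmem := elim_mem_Prin_hatm m g fun z => (e (Sum.inr z) + 1) / 2
  refine ⟨hatd g d - e - _, ?_, by rw [sub_sub_cancel]; exact hmem⟩
  rintro (v | z)
  · simp only [Pi.sub_apply, hatd, Sum.elim_inl]
    have hE : e (Sum.inl v) + ∑ i, e (Sum.inr ⟨v, i⟩) ≤ deg e := by
      rw [deg, Fintype.sum_sum_type, Fintype.sum_sigma]
      exact add_le_add
        (Finset.single_le_sum (f := fun w => e (Sum.inl w)) (fun w _ => he _) (Finset.mem_univ v))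
        (Finset.single_le_sum (f := fun w => ∑ i, e (Sum.inr ⟨w, i⟩))
          (fun w _ => Finset.sum_nonneg fun i _ => he _) (Finset.mem_univ v))
    have h1 : 2 * ∑ i, (e (Sum.inr ⟨v, i⟩) + 1) / 2 ≤ ∑ i, e (Sum.inr ⟨v, i⟩) + g v := by
      have : ∑ i, e (Sum.inr ⟨v, i⟩) + (g v : ℤ) = ∑ i, (e (Sum.inr ⟨v, i⟩) + 1) := by
        simp [Finset.sum_add_distrib]
      rw [this, Finset.mul_sum]
      exact Finset.sum_le_sum fun i _ => by omega
    have h2 : 2 * ∑ i, (e (Sum.inr ⟨v, i⟩) + 1) / 2 ≤ 2 * ∑ i, e (Sum.inr ⟨v, i⟩) := by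
      rw [Finset.mul_sum, Finset.mul_sum]
      exact Finset.sum_le_sum fun i _ => by have := he (Sum.inr ⟨v, i⟩); omega
    have h3 := he (Sum.inl v)
    rcases le_max_iff.mp (hdeg v) with h | h <;> omega
  · simp only [Pi.sub_apply, hatd, Sum.elim_inr]
    omega

/-- If `d` is `u`-reduced, then for every `k > d_rk u` some effective divisor of degree `k`
on `Ĝ` cannot be subtracted from `d`. -/
theorem Reduced.exists_not_equivEff_hatd_sub {V : Type*} [Fintype V] [DecidableEq V]
    {m : V → V → ℕ} {u : V} {d : V → ℤ} (hd : Reduced m u d) (g : V → ℕ) {k : ℤ}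
    (hk : 0 ≤ k) (hku : drk g d u < k) :
    ∃ e : (V ⊕ Σ v : V, Fin (g v)) → ℤ, Effective e ∧ deg e = k ∧
      ¬ EquivEff (hatm m g) (hatd g d - e) := by
  obtain ⟨n, rfl⟩ := Int.eq_ofNat_of_zero_le hk
  set s : ℕ := min n (g u) with hs
  have hsn : s ≤ n := min_le_left _ _
  have hsg : s ≤ g u := min_le_right _ _
  set c : (Σ v : V, Fin (g v)) → ℤ := fun z => if z.1 = u ∧ z.2.val < s then 1 else 0 with hc
  have hc0 : ∀ z, 0 ≤ c z := fun z => by simp only [hc]; split_ifs <;> norm_num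
  have hc1 : ∀ z, c z ≤ 1 := fun z => by simp only [hc]; split_ifs <;> norm_num
  have hcu : ∑ i, c ⟨u, i⟩ = s := by
    simp [hc, Fin.card_filter_val_lt, hsg]
  have hcv : ∀ v, v ≠ u → ∑ i, c ⟨v, i⟩ = 0 := fun v hv => by simp [hc, hv]
  refine ⟨Sum.elim (Pi.single u ((n : ℤ) - s)) c, ?_, ?_, fun hE => ?_⟩
  · rintro (v | z)
    · rw [Sum.elim_inl]
      by_cases hv : v = u
      · subst hv
        simpa using hsn
      · simp [hv]
    · exact hc0 z
  · rw [deg, Fintype.sum_sum_type, Fintype.sum_sigma]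
    simp only [Sum.elim_inl, Sum.elim_inr]
    rw [Finset.sum_pi_single', if_pos (Finset.mem_univ u),
      Finset.sum_eq_single u (fun v _ hv => hcv v hv) (by simp), hcu]
    simp
  · obtain ⟨e₀, he₀, hp⟩ := hE
    have hmem := elim_mem_Prin_hatm m g c
    have hred := hd.reduced_hatm (g := g)
      (f := hatd g d - Sum.elim (Pi.single u ((n : ℤ) - s)) c -
        Sum.elim (fun v => 2 * ∑ i, c ⟨v, i⟩) fun z => -(2 * c z))
      (fun v hv => by simp [hatd, hv, hcv v hv])
      (fun z => by
        simp only [Pi.sub_apply, hatd, Sum.elim_inr]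
        linarith [hc0 z])
      (fun z => by
        simp only [Pi.sub_apply, hatd, Sum.elim_inr]
        linarith [hc1 z])
    have h0 := hred.nonneg_of_equivEff
      ⟨e₀, he₀, by rw [sub_right_comm]; exact AddSubgroup.sub_mem _ hp hmem⟩
    simp only [Pi.sub_apply, hatd, Sum.elim_inl, Pi.single_eq_same, hcu] at h0
    obtain ⟨h1, h2⟩ := max_lt_iff.mp hku
    omega

/-- On a weighted graph, if `d` is `u`-reduced (on the underlying loopless
multigraph) for a vertex `u` with `d_rk u = ℓ_G(d)`, then `r_G(d) = ℓ_G(d)`. -/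
theorem stmt10 {V : Type*} [Fintype V] [DecidableEq V] [Nonempty V]
    (m : V → V → ℕ) (hsymm : ∀ v w, m v w = m w v) (hloop : ∀ v, m v v = 0)
    (hconn : Conn m) (g : V → ℕ) (d : V → ℤ) (u : V)
    (hu : drk g d u = ellw g d) (hred : Reduced m u d) :
    wrank m g d = ellw g d := by
  refine IsGreatest.csSup_eq ⟨?_, ?_⟩
  · by_cases hd : Effective d
    · have hl : ellw g d = Finset.univ.inf' Finset.univ_nonempty (drk g d) := if_pos hd
      have hle : ∀ v, ellw g d ≤ drk g d v := fun v => by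
        rw [hl]
        exact Finset.inf'_le _ (Finset.mem_univ v)
      refine Or.inr ⟨?_, fun e he hdeg => equivEff_hatd_sub m g d he fun v => hdeg ▸ hle v⟩
      rw [← hu]
      exact le_max_of_le_right (Int.ediv_nonneg (hd u) (by norm_num))
    · exact Or.inl (if_neg hd)
  · rintro k (rfl | ⟨hk, h⟩)
    · by_cases hd : Effective d
      · rw [← hu]
        exact le_max_of_le_right (le_trans (by norm_num) (Int.ediv_nonneg (hd u) (by norm_num)))
      · exact (if_neg hd : ellw g d = -1).ge
    · by_contra! hlt
      obtain ⟨e, he, hdeg, hne⟩ := hred.exists_not_equivEff_hatd_sub g hk (hu ▸ hlt)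
      exact hne (h e he hdeg)
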